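/- Let A be a graded algebra over a field K such that each graded piece is finite dimensional and the grades appearing in A are bounded below, and suppose every indecomposable graded A-module is absolutely indecomposable. Then the category of finitely generated projective graded left A-modules is Krull-Schmidt, has finitely many indecomposables up to grading shift, and for any two finitely generated projectives M, N, the degree-i Hom space Hom(M, N(i)) vanishes for i ≪ 0 and each Hom(M,N(i)) is finite dimensional. -/

import Mathlib

/-!
Statement 8: for a graded `K`-algebra `A` with finite-dimensional graded pieces
and grades bounded below, all of whose indecomposable graded modules are
absolutely indecomposable (local endomorphism rings with residue field `K`),
the category of finitely generated projective graded left `A`-modules is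
Krull–Schmidt, has finitely many indecomposables up to grading shift, and has
Hom spaces `Hom(M, N(i))` which are finite dimensional and vanish for `i ≪ 0`.
-/

noncomputable section

variable (K : Type) [Field K] (A : Type) [Ring A] [Algebra K A]
variable (𝒜 : ℤ → Submodule K A)

/-- A graded left `A`-module for the grading `𝒜` of `A`:  an `A`-module with a
compatible internal direct-sum decomposition into `K`-subspaces. -/
structure GrMod : Type 1 where
  carrier : Type
  [acg : AddCommGroup carrier]
  [modA : Module A carrier]
  [modK : Module K carrier]
  [tower : IsScalarTower K A carrier]
  [smulcomm : SMulCommClass A K carrier]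
  grading : ℤ → Submodule K carrier
  internal : DirectSum.IsInternal grading
  smul_mem : ∀ ⦃i j : ℤ⦄ ⦃a : A⦄, a ∈ 𝒜 i → ∀ ⦃m : carrier⦄,
    m ∈ grading j → a • m ∈ grading (i + j)

attribute [instance] GrMod.acg GrMod.modA GrMod.modK GrMod.tower GrMod.smulcomm

variable {K A 𝒜}

/-- The space of `A`-linear maps of degree `i` (raising degrees by `i`),
as a `K`-subspace of the `A`-linear maps. -/
def homDeg (M N : GrMod K A 𝒜) (i : ℤ) :
    Submodule K (M.carrier →ₗ[A] N.carrier) where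
  carrier := {f | ∀ (j : ℤ) (x : M.carrier), x ∈ M.grading j → f x ∈ N.grading (j + i)}
  add_mem' hf hg j x hx := by
    simpa using Submodule.add_mem _ (hf j x hx) (hg j x hx)
  zero_mem' j x hx := by simp
  smul_mem' k f hf j x hx := by
    simpa using Submodule.smul_mem _ k (hf j x hx)

/-- Finitely generated projective (as an ungraded `A`-module). -/
def FGProj (M : GrMod K A 𝒜) : Prop :=
  Module.Finite A M.carrier ∧ Module.Projective A M.carrier

/-- Indecomposability of a graded module:  it is nonzero and every degree-0
graded idempotent endomorphism is trivial. -/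
def IndecGr (M : GrMod K A 𝒜) : Prop :=
  (∃ x : M.carrier, x ≠ 0) ∧
  ∀ f ∈ homDeg M M 0, f ∘ₗ f = f → f = 0 ∨ f = LinearMap.id

/-- A Krull–Schmidt decomposition of `M`: a finite complete family of
orthogonal, primitive, degree-0 graded idempotent endomorphisms. -/
def KSDecomp (M : GrMod K A 𝒜) : Prop :=
  ∃ (n : ℕ) (e : Fin n → (M.carrier →ₗ[A] M.carrier)),
    (∀ i, e i ∈ homDeg M M 0) ∧
    (∀ i, (e i) ∘ₗ (e i) = e i) ∧
    (∀ i j, i ≠ j → (e i) ∘ₗ (e j) = 0) ∧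
    (∑ i, e i) = LinearMap.id ∧
    (∀ i, e i ≠ 0 ∧ ∀ f ∈ homDeg M M 0, f ∘ₗ f = f →
      f ∘ₗ (e i) = f → (e i) ∘ₗ f = f → f = 0 ∨ f = e i)

/-- An isomorphism `M ≅ N(k)` of graded modules (a graded iso of degree `k`). -/
def ShiftIso (M N : GrMod K A 𝒜) (k : ℤ) : Prop :=
  ∃ f : M.carrier ≃ₗ[A] N.carrier,
    ∀ (j : ℤ) (x : M.carrier), x ∈ M.grading j ↔ f x ∈ N.grading (j + k)


theorem ks_unit_or_nilp {K B : Type*} [Field K] [Ring B] [Algebra K B] [FiniteDimensional K B]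
    (hB : ∀ e : B, e * e = e → e = 0 ∨ e = 1) (f : B) : IsUnit f ∨ IsNilpotent f := by
  classical
  have hint : IsIntegral K f := IsIntegral.of_finite K f
  have hne := minpoly.ne_zero hint
  obtain ⟨q, hq, hnd⟩ := Polynomial.exists_eq_pow_rootMultiplicity_mul_and_not_dvd (minpoly K f) hne 0
  set n := Polynomial.rootMultiplicity 0 (minpoly K f)
  simp only [map_zero, sub_zero] at hq hnd
  have hcop : IsCoprime ((Polynomial.X : Polynomial K) ^ (n+1)) q :=
    IsCoprime.pow_left ((Polynomial.irreducible_X.coprime_iff_not_dvd).2 hnd)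
  obtain ⟨a, b, hab⟩ := hcop
  have h0 : f ^ n * Polynomial.aeval f q = 0 := by
    have := minpoly.aeval K f
    rw [hq] at this
    simpa using this
  have h1 : Polynomial.aeval f a * f ^ (n+1) + Polynomial.aeval f b * Polynomial.aeval f q = 1 := by
    have := congrArg (Polynomial.aeval f) hab
    simpa using this
  have ca : ∀ p : Polynomial K, Commute f (Polynomial.aeval f p) := fun p => by
    have := congrArg (Polynomial.aeval f) (mul_comm Polynomial.X p)
    simpa [Commute, SemiconjBy] using this
  have cab : ∀ p r : Polynomial K, Commute (Polynomial.aeval f r) (Polynomial.aeval f p) := fun p r => by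
    have := congrArg (Polynomial.aeval f) (mul_comm r p)
    simpa [Commute, SemiconjBy] using this
  set a' := Polynomial.aeval f a
  set b' := Polynomial.aeval f b
  set q' := Polynomial.aeval f q
  have hfq : f ^ (n+1) * q' = 0 := by rw [pow_succ', mul_assoc, h0, mul_zero]
  have hfbq : f ^ (n+1) * (b' * q') = 0 := by
    rw [(cab q b).eq, ← mul_assoc, hfq, zero_mul]
  rcases hB (a' * f ^ (n+1)) (by
    have : a' * f ^ (n+1) * (a' * f ^ (n+1) + b' * q') = a' * f ^ (n+1) := by rw [h1, mul_one]
    rwa [mul_add, mul_assoc a' _ (b' * q'), hfbq, mul_zero, add_zero] at this) with h | h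
  · right
    refine ⟨n+1, ?_⟩
    rw [h, zero_add] at h1
    rw [h1, mul_one] at hfbq
    exact hfbq
  · left
    have c2 : Commute f (a' * f ^ n) := (ca a).mul_right (Commute.self_pow f n)
    have h2 : (a' * f ^ n) * f = 1 := by rw [mul_assoc, ← pow_succ]; exact h
    exact ⟨⟨f, a' * f ^ n, by rw [c2.eq, h2], h2⟩, rfl⟩

theorem ks_unit_add {K B : Type*} [Field K] [Ring B] [Algebra K B] [FiniteDimensional K B]
    (hB : ∀ e : B, e * e = e → e = 0 ∨ e = 1) (f g : B) (h : IsUnit (f + g)) :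
    IsUnit f ∨ IsUnit g := by
  obtain ⟨u, hu⟩ := h
  have h1 : ((u⁻¹ : Bˣ) : B) * f + ((u⁻¹ : Bˣ) : B) * g = 1 := by
    rw [← mul_add, ← hu, Units.inv_mul]
  rcases ks_unit_or_nilp (K := K) hB (((u⁻¹ : Bˣ) : B) * f) with h | h
  · left
    simpa using h
  · right
    have := h.isUnit_one_sub
    rw [← h1, add_sub_cancel_left] at this
    simpa using this

theorem ks_unit_sum {K B ι : Type*} [Field K] [Ring B] [Algebra K B] [FiniteDimensional K B]
    [Nontrivial B]
    (hB : ∀ e : B, e * e = e → e = 0 ∨ e = 1) (s : Finset ι) (f : ι → B)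
    (h : IsUnit (∑ i ∈ s, f i)) : ∃ i, IsUnit (f i) := by
  classical
  induction s using Finset.induction_on with
  | empty => simp at h
  | insert i s hi ih =>
    rw [Finset.sum_insert hi] at h
    rcases ks_unit_add (K := K) hB _ _ h with h | h
    · exact ⟨i, h⟩
    · exact ih h

theorem ks_decomp_aux {K B : Type} [Field K] [Ring B] [Algebra K B] [FiniteDimensional K B]
    (S : Submodule K B) : ∀ e : B, e * e = e → LinearMap.range (LinearMap.mulLeft K e) = S →
    ∃ (ι : Type) (_ : Fintype ι) (c : ι → B),
      (∀ i, c i * c i = c i) ∧ (∀ i j, i ≠ j → c i * c j = 0) ∧ (∑ i, c i) = e ∧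
      (∀ i, c i * e = c i) ∧ (∀ i, e * c i = c i) ∧
      (∀ i, c i ≠ 0 ∧ ∀ f, f * f = f → f * c i = f → c i * f = f → f = 0 ∨ f = c i) := by
  classical
  induction S using WellFoundedLT.induction with
  | ind S ih =>
  intro e he hS
  by_cases h0 : e = 0
  · refine ⟨Empty, inferInstance, fun x => x.elim, ?_⟩
    simp [h0]
  by_cases hp : ∀ f, f * f = f → f * e = f → e * f = f → f = 0 ∨ f = e
  · refine ⟨Unit, inferInstance, fun _ => e, ?_⟩
    refine ⟨fun _ => he, fun i j h => (h rfl).elim, by simp, fun _ => he, fun _ => he, fun _ => ⟨h0, hp⟩⟩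
  push Not at hp
  obtain ⟨f, hf, hfe, hef, hf0, hfe'⟩ := hp
  have key : ∀ f : B, f * f = f → f * e = f → e * f = f → f ≠ e →
      LinearMap.range (LinearMap.mulLeft K f) < S := by
    intro f hf hfe hef hne
    refine lt_of_le_of_ne ?_ ?_
    · rw [← hS]
      rintro _ ⟨x, rfl⟩
      exact ⟨f * x, by simp [← mul_assoc, hef]⟩
    · intro h
      have : e ∈ LinearMap.range (LinearMap.mulLeft K f) := by
        rw [h, ← hS]; exact ⟨e, by simp [he]⟩
      obtain ⟨x, hx⟩ := this
      simp only [LinearMap.mulLeft_apply] at hx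
      apply hne
      rw [← hfe, ← hx, ← mul_assoc, hf]
  have hg : (e - f) * (e - f) = e - f := by simp [mul_sub, sub_mul, he, hf, hfe, hef]
  obtain ⟨ι, _, c, c1, c2, c3, c4, c5, c6⟩ := ih _ (key f hf hfe hef hfe') f hf rfl
  obtain ⟨κ, _, d, d1, d2, d3, d4, d5, d6⟩ := ih _ (key (e - f) hg (by simp [sub_mul, he, hfe])
    (by simp [mul_sub, he, hef]) (by simpa using hf0)) (e - f) hg rfl
  refine ⟨ι ⊕ κ, inferInstance, Sum.elim c d, ?_, ?_, ?_, ?_, ?_, ?_⟩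
  · rintro (i | i); exacts [c1 i, d1 i]
  · rintro (i | i) (j | j) hij
    · exact c2 i j (fun h => hij (by rw [h]))
    · show c i * d j = 0
      rw [← c4 i, ← d5 j, mul_assoc, ← mul_assoc f, mul_sub, hfe, hf]; simp
    · show d i * c j = 0
      rw [← d4 i, ← c5 j, mul_assoc, ← mul_assoc (e - f), sub_mul, hef, hf]; simp
    · exact d2 i j (fun h => hij (by rw [h]))
  · simp [c3, d3]
  · rintro (i | i)
    · show c i * e = c i
      rw [← c4 i, mul_assoc, hfe]
    · show d i * e = d i
      rw [← d4 i, mul_assoc, sub_mul, he, hfe]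
  · rintro (i | i)
    · show e * c i = c i
      rw [← c5 i, ← mul_assoc, hef]
    · show e * d i = d i
      rw [← d5 i, ← mul_assoc, mul_sub, he, hef]
  · rintro (i | i); exacts [c6 i, d6 i]

theorem ks_decomp (K B : Type) [Field K] [Ring B] [Algebra K B] [FiniteDimensional K B] :
    ∃ (n : ℕ) (c : Fin n → B),
      (∀ i, c i * c i = c i) ∧ (∀ i j, i ≠ j → c i * c j = 0) ∧ (∑ i, c i) = 1 ∧
      (∀ i, c i ≠ 0 ∧ ∀ f, f * f = f → f * c i = f → c i * f = f → f = 0 ∨ f = c i) := by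
  obtain ⟨ι, _, c, c1, c2, c3, c4, c5, c6⟩ := ks_decomp_aux (K := K) (B := B) _ 1 (one_mul 1) rfl
  let φ := (Fintype.equivFin ι).symm
  refine ⟨Fintype.card ι, c ∘ φ, fun i => c1 _, fun i j h => c2 _ _ (fun h' => h (φ.injective h')), ?_,
    fun i => c6 _⟩
  rw [← c3]
  exact Equiv.sum_comp φ c

section grad
variable {K V : Type} [Field K] [AddCommGroup V] [Module K V] {𝒱 : ℤ → Submodule K V}

def gEquiv (h : DirectSum.IsInternal 𝒱) : (DirectSum ℤ fun i => 𝒱 i) ≃ₗ[K] V :=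
  LinearEquiv.ofBijective (DirectSum.coeLinearMap 𝒱) h

def gproj (h : DirectSum.IsInternal 𝒱) (j : ℤ) : V →ₗ[K] V :=
  (𝒱 j).subtype ∘ₗ DirectSum.component K ℤ (fun i => 𝒱 i) j ∘ₗ (gEquiv h).symm.toLinearMap

theorem gEquiv_symm (h : DirectSum.IsInternal 𝒱) {j : ℤ} {x : V} (hx : x ∈ 𝒱 j) :
    (gEquiv h).symm x = DirectSum.lof K ℤ (fun i => 𝒱 i) j ⟨x, hx⟩ := by
  rw [LinearEquiv.symm_apply_eq]
  exact (DirectSum.coeLinearMap_lof 𝒱 j ⟨x, hx⟩).symm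

theorem gproj_mem (h : DirectSum.IsInternal 𝒱) (j : ℤ) (x : V) : gproj h j x ∈ 𝒱 j := by
  simp [gproj]

theorem gproj_same (h : DirectSum.IsInternal 𝒱) {j : ℤ} {x : V} (hx : x ∈ 𝒱 j) :
    gproj h j x = x := by
  simp [gproj, gEquiv_symm h hx, DirectSum.component.lof_self]

theorem gproj_ne (h : DirectSum.IsInternal 𝒱) {i j : ℤ} (hij : i ≠ j) {x : V} (hx : x ∈ 𝒱 i) :
    gproj h j x = 0 := by
  simp [gproj, gEquiv_symm h hx, DirectSum.component.of, hij]

theorem gproj_ext (h : DirectSum.IsInternal 𝒱) {x y : V} (hxy : ∀ j, gproj h j x = gproj h j y) :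
    x = y := by
  apply (gEquiv h).symm.injective
  refine DFinsupp.ext fun j => ?_
  exact Subtype.ext (hxy j)

theorem gind (h : DirectSum.IsInternal 𝒱) {p : V → Prop} (hom : ∀ j x, x ∈ 𝒱 j → p x)
    (add : ∀ x y, p x → p y → p (x + y)) (x : V) : p x := by
  have : x ∈ iSup 𝒱 := by rw [h.submodule_iSup_eq_top]; trivial
  exact Submodule.iSup_induction 𝒱 (motive := p) this hom (hom 0 0 (Submodule.zero_mem _)) add

end grad

/-! graded module lemmas -/

theorem gproj_smul (hinternal : DirectSum.IsInternal 𝒜) (M : GrMod K A 𝒜) {l : ℤ} {a : A}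
    (ha : a ∈ 𝒜 l) (j : ℤ) (y : M.carrier) :
    gproj M.internal (l + j) (a • y) = a • gproj M.internal j y := by
  refine gind M.internal (p := fun y => gproj M.internal (l + j) (a • y) = a • gproj M.internal j y)
    ?_ ?_ y
  · intro i x hx
    by_cases hij : i = j
    · subst hij
      rw [gproj_same _ hx, gproj_same _ (M.smul_mem ha hx)]
    · rw [gproj_ne _ hij hx, gproj_ne _ _ (M.smul_mem ha hx), smul_zero]
      intro h; apply hij; linarith
  · intro x y hx hy
    simp only [smul_add, map_add, hx, hy]

theorem gproj_smul' (hinternal : DirectSum.IsInternal 𝒜) (M : GrMod K A 𝒜) {d : ℤ} {m : M.carrier}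
    (hm : m ∈ M.grading d) (j : ℤ) (b : A) :
    gproj M.internal j (b • m) = gproj hinternal (j + -d) b • m := by
  refine gind hinternal (p := fun b => gproj M.internal j (b • m) = gproj hinternal (j + -d) b • m)
    ?_ ?_ b
  · intro i x hx
    by_cases hij : i = j + -d
    · subst hij
      rw [gproj_same _ hx]
      have := M.smul_mem hx hm
      rw [neg_add_cancel_right] at this
      rw [gproj_same _ this]
    · rw [gproj_ne _ hij hx, gproj_ne _ _ (M.smul_mem hx hm), zero_smul]
      intro h; apply hij; linarith
  · intro x y hx hy
    simp only [add_smul, map_add, hx, hy]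

/-- homogeneous generators -/
theorem exists_hom_gens (M : GrMod K A 𝒜) (hM : Module.Finite A M.carrier) :
    ∃ (n : ℕ) (d : Fin n → ℤ) (m : Fin n → M.carrier), (∀ k, m k ∈ M.grading (d k)) ∧
      Submodule.span A (Set.range m) = ⊤ := by
  let H : Set M.carrier := {x | ∃ j, x ∈ M.grading j}
  have hH : Submodule.span A H = ⊤ := by
    rw [eq_top_iff]
    intro x _
    refine gind M.internal (p := fun x => x ∈ Submodule.span A H) ?_ ?_ x
    · intro j x hx
      exact Submodule.subset_span ⟨j, hx⟩
    · intro x y hx hy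
      exact Submodule.add_mem _ hx hy
  have hfg : (Submodule.span A H).FG := by rw [hH]; exact hM.fg_top
  obtain ⟨s, hs, hs'⟩ := (Submodule.fg_span_iff_fg_span_finset_subset H).1 hfg
  let φ := s.equivFin.symm
  choose d hd using fun k : s => hs k.2
  refine ⟨s.card, fun k => d (φ k), fun k => (φ k : M.carrier), fun k => hd (φ k), ?_⟩
  rw [← hH, hs']
  congr 1
  ext x
  constructor
  · rintro ⟨k, rfl⟩
    exact (φ k).2
  · intro hx
    exact ⟨φ.symm ⟨x, hx⟩, by simp⟩

theorem gens_expand (hinternal : DirectSum.IsInternal 𝒜) (M : GrMod K A 𝒜) {n : ℕ} {d : Fin n → ℤ}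
    {m : Fin n → M.carrier} (hm : ∀ k, m k ∈ M.grading (d k))
    (hs : Submodule.span A (Set.range m) = ⊤) {j : ℤ} {y : M.carrier} (hy : y ∈ M.grading j) :
    ∃ a : ∀ k, 𝒜 (j + -(d k)), ∑ k, (a k : A) • m k = y := by
  have : y ∈ Submodule.span A (Set.range m) := by rw [hs]; trivial
  obtain ⟨b, hb⟩ := (Submodule.mem_span_range_iff_exists_fun A).1 this
  refine ⟨fun k => ⟨gproj hinternal (j + -(d k)) (b k), gproj_mem _ _ _⟩, ?_⟩
  rw [← gproj_same M.internal hy, ← hb, map_sum]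
  exact Finset.sum_congr rfl fun k _ => (gproj_smul' hinternal M (hm k) j (b k)).symm

theorem gr_findim (hinternal : DirectSum.IsInternal 𝒜) (hfin : ∀ n : ℤ, FiniteDimensional K (𝒜 n))
    (M : GrMod K A 𝒜) (hM : Module.Finite A M.carrier) (j : ℤ) :
    FiniteDimensional K (M.grading j) := by
  obtain ⟨n, d, m, hm, hs⟩ := exists_hom_gens M hM
  let Φ : (∀ k, 𝒜 (j + -(d k))) →ₗ[K] M.carrier :=
    ∑ k, ((LinearMap.toSpanSingleton A M.carrier (m k)).restrictScalars K) ∘ₗ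
      (𝒜 (j + -(d k))).subtype ∘ₗ LinearMap.proj k
  have hle : M.grading j ≤ LinearMap.range Φ := by
    intro y hy
    obtain ⟨a, ha⟩ := gens_expand hinternal M hm hs hy
    refine ⟨a, ?_⟩
    simpa [Φ] using ha
  exact Submodule.finiteDimensional_of_le hle

theorem gr_bdd (hinternal : DirectSum.IsInternal 𝒜) (hbdd : ∃ n₀ : ℤ, ∀ n : ℤ, n < n₀ → 𝒜 n = ⊥)
    (M : GrMod K A 𝒜) (hM : Module.Finite A M.carrier) :
    ∃ j₀ : ℤ, ∀ j, j < j₀ → ∀ y ∈ M.grading j, y = 0 := by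
  obtain ⟨n, d, m, hm, hs⟩ := exists_hom_gens M hM
  obtain ⟨n₀, hn₀⟩ := hbdd
  obtain ⟨D, hD⟩ := (Set.finite_range d).bddBelow
  refine ⟨n₀ + D, fun j hj y hy => ?_⟩
  obtain ⟨a, ha⟩ := gens_expand hinternal M hm hs hy
  rw [← ha]
  refine Finset.sum_eq_zero fun k _ => ?_
  have h1 : D ≤ d k := hD ⟨k, rfl⟩
  have h2 : (a k : A) = 0 :=
    (Submodule.mem_bot K).1 ((hn₀ (j + -(d k)) (by linarith)).le (a k).2)
  rw [h2, zero_smul]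

theorem hom_vanish (hinternal : DirectSum.IsInternal 𝒜)
    (hbdd : ∃ n₀ : ℤ, ∀ n : ℤ, n < n₀ → 𝒜 n = ⊥)
    (M N : GrMod K A 𝒜) (hM : Module.Finite A M.carrier) (hN : Module.Finite A N.carrier) :
    ∃ i₀ : ℤ, ∀ i : ℤ, i < i₀ → ∀ f ∈ homDeg M N i, f = 0 := by
  obtain ⟨n, d, m, hm, hs⟩ := exists_hom_gens M hM
  obtain ⟨j₀, hj₀⟩ := gr_bdd hinternal hbdd N hN
  obtain ⟨D, hD⟩ := (Set.finite_range d).bddAbove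
  refine ⟨j₀ - D, fun i hi f hf => ?_⟩
  refine LinearMap.ext_on_range hs fun k => ?_
  have h1 : d k ≤ D := hD ⟨k, rfl⟩
  exact hj₀ _ (by linarith) _ (hf _ _ (hm k))

theorem hom_findim (hinternal : DirectSum.IsInternal 𝒜)
    (hfin : ∀ n : ℤ, FiniteDimensional K (𝒜 n))
    (M N : GrMod K A 𝒜) (hM : Module.Finite A M.carrier) (hN : Module.Finite A N.carrier) (i : ℤ) :
    FiniteDimensional K (homDeg M N i) := by
  obtain ⟨n, d, m, hm, hs⟩ := exists_hom_gens M hM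
  have := gr_findim hinternal hfin N hN
  let Φ : homDeg M N i →ₗ[K] (∀ k, N.grading (d k + i)) :=
    { toFun := fun f k => ⟨f.1 (m k), f.2 _ _ (hm k)⟩
      map_add' := fun f g => by ext k; simp
      map_smul' := fun c f => by ext k; simp }
  refine Module.Finite.of_injective Φ ?_
  intro f g hfg
  apply Subtype.ext
  refine LinearMap.ext_on_range hs fun k => ?_
  exact congrArg Subtype.val (congrFun hfg k)

theorem deg_reflect {M N : GrMod K A 𝒜} {k : ℤ} {f : M.carrier →ₗ[A] N.carrier}
    (hf : f ∈ homDeg M N k) (hinj : Function.Injective f) {j : ℤ} {x : M.carrier}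
    (hx : f x ∈ N.grading (j + k)) : x ∈ M.grading j := by
  have key : ∀ x i, gproj N.internal (i + k) (f x) = f (gproj M.internal i x) := by
    intro x i
    refine gind M.internal
      (p := fun x => gproj N.internal (i + k) (f x) = f (gproj M.internal i x)) ?_ ?_ x
    · intro l x hx
      by_cases h : l = i
      · subst h
        rw [gproj_same _ hx, gproj_same _ (hf _ _ hx)]
      · rw [gproj_ne _ h hx, gproj_ne _ _ (hf _ _ hx), map_zero]
        intro h'; apply h; linarith
    · intro x y hx hy
      simp only [map_add, hx, hy]
  have h1 := key x j
  rw [gproj_same _ hx] at h1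
  rw [hinj h1]
  exact gproj_mem _ _ _

theorem homDeg_comp {M N P : GrMod K A 𝒜} {i j : ℤ} {f : M.carrier →ₗ[A] N.carrier}
    {g : N.carrier →ₗ[A] P.carrier} (hf : f ∈ homDeg M N i) (hg : g ∈ homDeg N P j) :
    g ∘ₗ f ∈ homDeg M P (i + j) := by
  intro l x hx
  rw [← add_assoc]
  exact hg _ _ (hf _ _ hx)

/-- The algebra of degree 0 endomorphisms. -/
def gEnd (M : GrMod K A 𝒜) : Subalgebra K (Module.End A M.carrier) where
  carrier := homDeg M M 0
  add_mem' := fun hf hg => (homDeg M M 0).add_mem hf hg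
  mul_mem' := fun {f g} hf hg => by
    have := homDeg_comp hg hf
    rwa [add_zero] at this
  algebraMap_mem' := fun c j x hx => by
    rw [add_zero]
    exact (M.grading j).smul_mem c hx

theorem gEnd_findim (hinternal : DirectSum.IsInternal 𝒜)
    (hfin : ∀ n : ℤ, FiniteDimensional K (𝒜 n))
    (M : GrMod K A 𝒜) (hM : Module.Finite A M.carrier) : FiniteDimensional K (gEnd M) :=
  hom_findim hinternal hfin M M hM hM 0

theorem inv_mem {M : GrMod K A 𝒜} {f : M.carrier →ₗ[A] M.carrier}
    (hf : f ∈ homDeg M M 0) (hb : Function.Bijective f) :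
    ∃ g ∈ homDeg M M 0, g ∘ₗ f = LinearMap.id ∧ f ∘ₗ g = LinearMap.id := by
  let e := LinearEquiv.ofBijective f hb
  refine ⟨e.symm.toLinearMap, ?_, ?_, ?_⟩
  · intro j x hx
    rw [add_zero]
    apply deg_reflect hf hb.1
    rw [add_zero]
    have : f (e.symm x) = x := e.apply_symm_apply x
    simpa [this] using hx
  · ext x; exact e.symm_apply_apply x
  · ext x; exact e.apply_symm_apply x

theorem gEnd_isUnit {M : GrMod K A 𝒜} (f : gEnd M) :
    IsUnit f ↔ Function.Bijective (f : Module.End A M.carrier) := by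
  constructor
  · intro h
    have := h.map (gEnd M).val
    exact (Module.End.isUnit_iff _).1 this
  · intro h
    obtain ⟨g, hg, h1, h2⟩ := inv_mem f.2 h
    exact ⟨⟨f, ⟨g, hg⟩, Subtype.ext h2, Subtype.ext h1⟩, rfl⟩

theorem gEnd_idem {M : GrMod K A 𝒜} (hM : IndecGr M) (e : gEnd M) (he : e * e = e) :
    e = 0 ∨ e = 1 := by
  rcases hM.2 e.1 e.2 (congrArg Subtype.val he) with h | h
  · left; exact Subtype.ext h
  · right; exact Subtype.ext h

theorem gEnd_sum (hinternal : DirectSum.IsInternal 𝒜)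
    (hfin : ∀ n : ℤ, FiniteDimensional K (𝒜 n))
    (M : GrMod K A 𝒜) (hM : Module.Finite A M.carrier) (hI : IndecGr M) {n : ℕ}
    (f : Fin n → (M.carrier →ₗ[A] M.carrier)) (hf : ∀ i, f i ∈ homDeg M M 0)
    (hb : Function.Bijective (∑ i, f i : M.carrier →ₗ[A] M.carrier)) :
    ∃ i, Function.Bijective (f i) := by
  have := gEnd_findim hinternal hfin M hM
  have : Nontrivial (gEnd M) := by
    obtain ⟨x, hx⟩ := hI.1
    refine ⟨0, 1, fun h => hx ?_⟩
    have := congrArg (fun g : gEnd M => (g : Module.End A M.carrier) x) h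
    simpa using this.symm
  obtain ⟨i, hi⟩ := ks_unit_sum (K := K) (B := gEnd M) (gEnd_idem hI) Finset.univ
    (fun i => ⟨f i, hf i⟩) (by
      rw [gEnd_isUnit]
      convert hb
      simp)
  exact ⟨i, (gEnd_isUnit _).1 hi⟩

theorem gr_ksdecomp (hinternal : DirectSum.IsInternal 𝒜)
    (hfin : ∀ n : ℤ, FiniteDimensional K (𝒜 n))
    (M : GrMod K A 𝒜) (hM : Module.Finite A M.carrier) : KSDecomp M := by
  have := gEnd_findim hinternal hfin M hM
  obtain ⟨n, c, c1, c2, c3, c4⟩ := ks_decomp K (gEnd M)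
  refine ⟨n, fun i => (c i).1, fun i => (c i).2, fun i => congrArg Subtype.val (c1 i),
    fun i j h => congrArg Subtype.val (c2 i j h), ?_, fun i => ⟨?_, ?_⟩⟩
  · have := congrArg (gEnd M).val c3
    rw [map_sum] at this
    exact this
  · intro h
    exact (c4 i).1 (Subtype.ext h)
  · intro f hf h1 h2 h3
    rcases (c4 i).2 ⟨f, hf⟩ (Subtype.ext h1) (Subtype.ext h2) (Subtype.ext h3) with h | h
    · left; exact congrArg Subtype.val h
    · right; exact congrArg Subtype.val h

theorem deg_component (hinternal : DirectSum.IsInternal 𝒜) {M N : GrMod K A 𝒜}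
    (φ : M.carrier →ₗ[A] N.carrier) (i : ℤ) :
    ∃ ψ ∈ homDeg M N i, ∀ j, ∀ x ∈ M.grading j, ψ x = gproj N.internal (j + i) (φ x) := by
  let F : M.carrier →ₗ[K] N.carrier :=
    DirectSum.toModule K ℤ N.carrier (fun j => gproj N.internal (j + i) ∘ₗ φ.restrictScalars K ∘ₗ
      (M.grading j).subtype) ∘ₗ (gEquiv M.internal).symm.toLinearMap
  have hF : ∀ j, ∀ x ∈ M.grading j, F x = gproj N.internal (j + i) (φ x) := by
    intro j x hx
    simp only [F, LinearMap.comp_apply, LinearEquiv.coe_coe]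
    rw [gEquiv_symm M.internal hx, DirectSum.toModule_lof]
    rfl
  have hsm : ∀ (a : A) (x : M.carrier), F (a • x) = a • F x := by
    intro a x
    refine gind hinternal (p := fun a => F (a • x) = a • F x) ?_ ?_ a
    · intro l a ha
      refine gind M.internal (p := fun x => F (a • x) = a • F x) ?_ ?_ x
      · intro j x hx
        rw [hF _ _ hx, hF _ _ (M.smul_mem ha hx), map_smul, add_assoc,
          gproj_smul hinternal N ha]
      · intro x y hx hy
        simp only [smul_add, map_add, hx, hy]
    · intro a b ha hb
      simp only [add_smul, map_add, ha, hb]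
  refine ⟨{ toFun := F, map_add' := F.map_add, map_smul' := hsm }, ?_, hF⟩
  intro j x hx
  show F x ∈ _
  rw [hF j x hx]
  exact gproj_mem _ _ _

/-- The regular graded module. -/
def grReg (hmul : ∀ ⦃i j : ℤ⦄ ⦃a b : A⦄, a ∈ 𝒜 i → b ∈ 𝒜 j → a * b ∈ 𝒜 (i + j))
    (hinternal : DirectSum.IsInternal 𝒜) : GrMod K A 𝒜 where
  carrier := A
  grading := 𝒜
  internal := hinternal
  smul_mem := fun _ _ _ ha _ hm => hmul ha hm

/-- The image of a degree 0 idempotent. -/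
def grImg (M : GrMod K A 𝒜) (e : M.carrier →ₗ[A] M.carrier) (he : e ∈ homDeg M M 0) :
    GrMod K A 𝒜 where
  carrier := LinearMap.range e
  grading := fun j => (M.grading j).comap ((LinearMap.range e).subtype.restrictScalars K)
  smul_mem := fun _ _ _ ha _ hm => M.smul_mem ha hm
  internal := by
    apply DirectSum.isInternal_submodule_of_iSupIndep_of_iSup_eq_top
    · intro j
      rw [Submodule.disjoint_def]
      intro x hx hx'
      have hle : (⨆ i, ⨆ (_ : i ≠ j), (M.grading i).comap
          ((LinearMap.range e).subtype.restrictScalars K)) ≤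
          LinearMap.ker (gproj M.internal j ∘ₗ (LinearMap.range e).subtype.restrictScalars K) := by
        refine iSup_le fun i => iSup_le fun hij => ?_
        intro y hy
        exact gproj_ne M.internal hij hy
      have h1 := hle hx'
      have h2 : gproj M.internal j x.1 = x.1 := gproj_same M.internal hx
      have h3 : gproj M.internal j x.1 = 0 := h1
      apply Subtype.ext
      rw [← h2, h3]; rfl
    · rw [eq_top_iff]
      rintro ⟨_, y, rfl⟩ _
      refine gind M.internal (p := fun y => (⟨e y, y, rfl⟩ : LinearMap.range e) ∈ (⨆ i, (M.grading i).comap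
          ((LinearMap.range e).subtype.restrictScalars K))) ?_ ?_ y
      · intro j x hx
        refine Submodule.mem_iSup_of_mem j ?_
        have := he j x hx
        rw [add_zero] at this
        exact this
      · intro x y hx hy
        convert Submodule.add_mem _ hx hy using 1
        apply Subtype.ext
        simp

theorem summand (hinternal : DirectSum.IsInternal 𝒜)
    (hfin : ∀ n : ℤ, FiniteDimensional K (𝒜 n))
    (hmul : ∀ ⦃i j : ℤ⦄ ⦃a b : A⦄, a ∈ 𝒜 i → b ∈ 𝒜 j → a * b ∈ 𝒜 (i + j))
    (M : GrMod K A 𝒜) (hM : FGProj M) (hI : IndecGr M) :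
    ∃ (d : ℤ) (s : M.carrier →ₗ[A] (grReg (K := K) hmul hinternal).carrier)
      (p : (grReg (K := K) hmul hinternal).carrier →ₗ[A] M.carrier),
      s ∈ homDeg M (grReg hmul hinternal) (-d) ∧ p ∈ homDeg (grReg hmul hinternal) M d ∧
      Function.Bijective (p ∘ₗ s) := by
  obtain ⟨n, d, m, hm, hs⟩ := exists_hom_gens M hM.1
  have := hM.2
  let R : GrMod K A 𝒜 := grReg hmul hinternal
  let p : Fin n → (R.carrier →ₗ[A] M.carrier) := fun k =>
    LinearMap.toSpanSingleton A M.carrier (m k)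
  have hp : ∀ k, p k ∈ homDeg R M (d k) := by
    intro k j x hx
    exact M.smul_mem hx (hm k)
  let Φ : (Fin n → A) →ₗ[A] M.carrier := Fintype.linearCombination A m
  have hΦ : Function.Surjective Φ := by
    rw [← LinearMap.range_eq_top, Fintype.range_linearCombination, hs]
  obtain ⟨σ, hσ⟩ := Module.projective_lifting_property Φ LinearMap.id hΦ
  choose s hs1 hs2 using fun k => deg_component hinternal (M := M) (N := R)
    (LinearMap.proj k ∘ₗ σ) (-(d k))
  have hid : (∑ k, p k ∘ₗ s k) = LinearMap.id := by
    ext x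
    refine gind M.internal (p := fun x => (∑ k, p k ∘ₗ s k) x = LinearMap.id x) ?_ ?_ x
    · intro j x hx
      have h1 : ∑ k, σ x k • m k = x := by
        have := LinearMap.congr_fun hσ x
        simpa [Φ, Fintype.linearCombination_apply] using this
      rw [LinearMap.sum_apply, LinearMap.id_apply]
      conv_rhs => rw [← gproj_same M.internal hx, ← h1, map_sum]
      refine Finset.sum_congr rfl fun k _ => ?_
      rw [gproj_smul' hinternal M (hm k), LinearMap.comp_apply, hs2 k j x hx]
      rfl
    · intro x y hx hy
      rw [map_add, hx, hy, map_add]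
  obtain ⟨k, hk⟩ := gEnd_sum hinternal hfin M hM.1 hI (fun k => p k ∘ₗ s k) (fun k => by
    have := homDeg_comp (hs1 k) (hp k)
    rwa [neg_add_cancel] at this) (by rw [hid]; exact Function.bijective_id)
  exact ⟨d k, s k, p k, hs1 k, hp k, hk⟩

theorem fin_indec (hinternal : DirectSum.IsInternal 𝒜)
    (hfin : ∀ n : ℤ, FiniteDimensional K (𝒜 n))
    (hmul : ∀ ⦃i j : ℤ⦄ ⦃a b : A⦄, a ∈ 𝒜 i → b ∈ 𝒜 j → a * b ∈ 𝒜 (i + j)) :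
    ∃ (n : ℕ) (reps : Fin n → GrMod K A 𝒜),
      ∀ M : GrMod K A 𝒜, FGProj M → IndecGr M →
        ∃ (i : Fin n) (k : ℤ), ShiftIso M (reps i) k := by
  obtain ⟨n, e, e1, e2, e3, e4, e5⟩ := gr_ksdecomp hinternal hfin (grReg (K := K) hmul hinternal)
    (inferInstanceAs (Module.Finite A A))
  refine ⟨n, fun i => grImg _ (e i) (e1 i), fun M hM hI => ?_⟩
  obtain ⟨d, s, p, hs, hp, hb⟩ := summand hinternal hfin hmul M hM hI
  have hdeg : ∀ i, p ∘ₗ e i ∘ₗ s ∈ homDeg M M 0 := fun i => by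
    have := homDeg_comp (homDeg_comp hs (e1 i)) hp
    rwa [add_zero, neg_add_cancel] at this
  obtain ⟨i, hi⟩ := gEnd_sum hinternal hfin M hM.1 hI (fun i => p ∘ₗ e i ∘ₗ s) hdeg (by
    convert hb
    have h : p ∘ₗ (∑ i, e i) ∘ₗ s = p ∘ₗ s := by rw [e4, LinearMap.id_comp]
    rw [← h]
    ext x
    simp)
  obtain ⟨v, hv, hv1, hv2⟩ := inv_mem (hdeg i) hi
  have hv1' : ∀ x, v (p (e i (s x))) = x := LinearMap.congr_fun hv1
  have hv2' : ∀ x, p (e i (s (v x))) = x := LinearMap.congr_fun hv2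
  have hee : ∀ x, e i (e i x) = e i x := LinearMap.congr_fun (e2 i)
  let g := e i ∘ₗ s ∘ₗ v ∘ₗ p ∘ₗ e i
  have hgd : g ∈ homDeg (grReg hmul hinternal) (grReg hmul hinternal) 0 := by
    have := homDeg_comp (homDeg_comp (homDeg_comp (homDeg_comp (e1 i) hp) hv) hs) (e1 i)
    simpa using this
  have hg : g = e i := by
    rcases (e5 i).2 g hgd (LinearMap.ext fun x => by simp [g, hee, hv1'])
      (LinearMap.ext fun x => by simp [g, hee]) (LinearMap.ext fun x => by simp [g, hee]) with h | h
    · exfalso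
      obtain ⟨x, hx⟩ := hI.1
      apply hx
      have h1 : p (g (s x)) = p (e i (s x)) := by simp [g, hv1']
      rw [h] at h1
      rw [← hv1' x, ← h1]
      simp
    · exact h
  refine ⟨i, -d, ?_⟩
  let T : M.carrier →ₗ[A] (grImg _ (e i) (e1 i)).carrier := (e i).rangeRestrict ∘ₗ s
  have hT : ∀ x, (T x).1 = e i (s x) := fun x => rfl
  have hTd : T ∈ homDeg M (grImg _ (e i) (e1 i)) (-d) := by
    have := homDeg_comp hs (e1 i)
    rw [add_zero] at this
    exact this
  have hTinj : Function.Injective T := by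
    intro x y hxy
    have h := congrArg Subtype.val hxy
    rw [hT, hT] at h
    rw [← hv1' x, h, hv1']
  have hTsurj : Function.Surjective T := by
    rintro ⟨_, y, rfl⟩
    refine ⟨v (p (e i y)), Subtype.ext ?_⟩
    rw [hT]
    exact LinearMap.congr_fun hg y
  refine ⟨LinearEquiv.ofBijective T ⟨hTinj, hTsurj⟩, fun j x => ⟨fun hx => hTd j x hx, fun hx => ?_⟩⟩
  exact deg_reflect hTd hTinj hx

theorem graded_projectives_krullSchmidt
    (hone : (1 : A) ∈ 𝒜 0)
    (hmul : ∀ ⦃i j : ℤ⦄ ⦃a b : A⦄, a ∈ 𝒜 i → b ∈ 𝒜 j → a * b ∈ 𝒜 (i + j))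
    (hinternal : DirectSum.IsInternal 𝒜)
    (hfin : ∀ n : ℤ, FiniteDimensional K (𝒜 n))
    (hbdd : ∃ n₀ : ℤ, ∀ n : ℤ, n < n₀ → 𝒜 n = ⊥)
    (habs : ∀ M : GrMod K A 𝒜, IndecGr M → ∀ f ∈ homDeg M M 0,
      ∃ a : K, ¬ Function.Bijective
        (f - (a • LinearMap.id : M.carrier →ₗ[A] M.carrier))) :
    -- Krull–Schmidt: decompositions into indecomposables exist ...
    (∀ M : GrMod K A 𝒜, FGProj M → KSDecomp M) ∧
    -- ... and indecomposables have local graded endomorphism rings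
    (∀ M : GrMod K A 𝒜, FGProj M → IndecGr M →
      ∀ f ∈ homDeg M M 0, ∀ g ∈ homDeg M M 0,
        ¬ Function.Bijective f → ¬ Function.Bijective g →
        ¬ Function.Bijective (f + g)) ∧
    -- finitely many indecomposables up to grading shift
    (∃ (n : ℕ) (reps : Fin n → GrMod K A 𝒜),
      ∀ M : GrMod K A 𝒜, FGProj M → IndecGr M →
        ∃ (i : Fin n) (k : ℤ), ShiftIso M (reps i) k) ∧
    -- Hom(M,N(i)) vanishes for i ≪ 0 ...
    (∀ M N : GrMod K A 𝒜, FGProj M → FGProj N →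
      ∃ i₀ : ℤ, ∀ i : ℤ, i < i₀ → ∀ f ∈ homDeg M N i, f = 0) ∧
    -- ... and each Hom(M,N(i)) is finite dimensional
    (∀ M N : GrMod K A 𝒜, FGProj M → FGProj N → ∀ i : ℤ,
      FiniteDimensional K (homDeg M N i)) := by
  refine ⟨fun M hM => gr_ksdecomp hinternal hfin M hM.1, ?_, fin_indec hinternal hfin hmul,
    fun M N hM hN => hom_vanish hinternal hbdd M N hM.1 hN.1,
    fun M N hM hN i => hom_findim hinternal hfin M N hM.1 hN.1 i⟩
  intro M hM hI f hf g hg hnf hng hfg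
  have := gEnd_findim hinternal hfin M hM.1
  rcases ks_unit_add (K := K) (B := gEnd M) (gEnd_idem hI) ⟨f, hf⟩ ⟨g, hg⟩
    ((gEnd_isUnit _).2 hfg) with h | h
  · exact hnf ((gEnd_isUnit _).1 h)
  · exact hng ((gEnd_isUnit _).1 h)

end
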